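/- arXiv:1806.07640 — 2 statements merged into one kernel-verified Lean document; each statement's English description precedes it below -/
import Mathlib

section
/- Fix n and suppose k(n) < m(n) < n. Then the random variables π_i for i ∈ C∖S are identically distributed, as are the π_i for i ∉ C, and the following expectation bounds hold: E(π_i) ≤ 1/(m(n) − k(n)) for every i ∈ C∖S, and E(π_i) ≤ 1/(n − m(n)) for every i ∉ C. -/
open MeasureTheory ProbabilityTheory Filter Finset Topology

noncomputable section

def deg {n : ℕ} (A : Matrix (Fin n) (Fin n) ℝ) (i : Fin n) : ℝ := ∑ j, A i j

def transMat {n : ℕ} (A : Matrix (Fin n) (Fin n) ℝ) : Matrix (Fin n) (Fin n) ℝ :=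
  fun i j => if deg A i = 0 then (if i = j then 1 else 0) else A i j / deg A i

def restart (n k : ℕ) : Fin n → ℝ := fun i => if (i : ℕ) < k then (1 : ℝ) / k else 0

def ppr {n : ℕ} (α : ℝ) (ν : Fin n → ℝ) (P : Matrix (Fin n) (Fin n) ℝ) : Fin n → ℝ :=
  (1 - α) • Matrix.vecMul ν (1 - α • P)⁻¹

def meanA (n m : ℕ) (p q : ℝ) : Matrix (Fin n) (Fin n) ℝ :=
  fun i j => if (i : ℕ) < m ∧ (j : ℕ) < m then q else p

structure PlantedModel {Ω : Type*} [MeasurableSpace Ω] (μ : Measure Ω)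
    (n m : ℕ) (p q : ℝ) (A : Ω → Matrix (Fin n) (Fin n) ℝ) : Prop where
  meas : ∀ i j, Measurable (fun ω => A ω i j)
  symm : ∀ ω i j, A ω i j = A ω j i
  diag : ∀ ω i, A ω i i = 0
  zeroOne : ∀ ω i j, A ω i j = 0 ∨ A ω i j = 1
  mean : ∀ i j : Fin n, i < j →
    μ {ω | A ω i j = 1} = ENNReal.ofReal (if (i : ℕ) < m ∧ (j : ℕ) < m then q else p)
  indep : iIndepFun
    (fun (e : {e : Fin n × Fin n // e.1 < e.2}) ω => A ω e.1.1 e.1.2) μ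

def norm2 {n : ℕ} (v : Fin n → ℝ) : ℝ := Real.sqrt (∑ i, v i ^ 2)

/-! ### Row-stochasticity of the transition matrix -/

lemma transMat_nonneg {n : ℕ} {A : Matrix (Fin n) (Fin n) ℝ} (hA : ∀ i j, 0 ≤ A i j)
    (i j : Fin n) : 0 ≤ transMat A i j := by
  unfold transMat
  split_ifs
  · exact zero_le_one
  · exact le_rfl
  · exact div_nonneg (hA i j) (Finset.sum_nonneg fun l _ => hA i l)

lemma sum_transMat {n : ℕ} (A : Matrix (Fin n) (Fin n) ℝ) (i : Fin n) :
    ∑ j, transMat A i j = 1 := by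
  unfold transMat
  split_ifs with h
  · simp
  · rw [← Finset.sum_div]
    exact div_self h

lemma restart_nonneg (n k : ℕ) (i : Fin n) : 0 ≤ restart n k i := by
  unfold restart
  split_ifs <;> positivity

lemma sum_restart {n k : ℕ} (hk : 1 ≤ k) (hkn : k ≤ n) : ∑ i, restart n k i = 1 := by
  have hk' : (k : ℝ) ≠ 0 := by positivity
  unfold restart
  rw [Fin.sum_univ_eq_sum_range (fun i => if i < k then (1 : ℝ) / k else 0) n,
    ← Finset.sum_filter]
  have : (Finset.range n).filter (· < k) = Finset.range k := by
    ext i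
    simp only [Finset.mem_filter, Finset.mem_range]
    omega
  rw [this]
  simp [hk']

/-! ### Personalized PageRank is a probability vector -/

lemma det_one_sub_smul_ne_zero {n : ℕ} {α : ℝ} (hα : α ∈ Set.Ioo (0 : ℝ) 1)
    {P : Matrix (Fin n) (Fin n) ℝ} (hP : ∀ i j, 0 ≤ P i j) (hsum : ∀ i, ∑ j, P i j = 1) :
    (1 - α • P).det ≠ 0 := by
  refine det_ne_zero_of_sum_row_lt_diag fun i => ?_
  have hoff : ∑ j ∈ Finset.univ.erase i, ‖(1 - α • P) i j‖
      = α * ∑ j ∈ Finset.univ.erase i, P i j := by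
    rw [Finset.mul_sum]
    refine Finset.sum_congr rfl fun j hj => ?_
    have hij : i ≠ j := (Finset.ne_of_mem_erase hj).symm
    simp [hij, abs_of_nonneg (hP i j), abs_of_pos hα.1]
  have hsplit := Finset.add_sum_erase Finset.univ (P i) (Finset.mem_univ i)
  rw [hsum i] at hsplit
  rw [hoff, eq_sub_of_add_eq' hsplit]
  refine lt_of_lt_of_le ?_ (Real.le_norm_self _)
  simp only [Matrix.sub_apply, Matrix.one_apply_eq, Matrix.smul_apply, smul_eq_mul]
  linarith [hα.2]

lemma ppr_eq_add {n : ℕ} {α : ℝ} (ν : Fin n → ℝ) {P : Matrix (Fin n) (Fin n) ℝ}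
    (hdet : (1 - α • P).det ≠ 0) (j : Fin n) :
    ppr α ν P j = (1 - α) * ν j + α * ∑ i, ppr α ν P i * P i j := by
  have h : Matrix.vecMul (ppr α ν P) (1 - α • P) = (1 - α) • ν := by
    unfold ppr
    rw [Matrix.smul_vecMul, Matrix.vecMul_vecMul,
      Matrix.nonsing_inv_mul _ (isUnit_iff_ne_zero.mpr hdet), Matrix.vecMul_one]
  have hj := congrFun h j
  rw [Matrix.vecMul_sub, Matrix.vecMul_one, Matrix.vecMul_smul] at hj
  simp only [Pi.sub_apply, Pi.smul_apply, smul_eq_mul, Matrix.vecMul, dotProduct] at hj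
  linarith

lemma ppr_nonneg {n : ℕ} {α : ℝ} (hα : α ∈ Set.Ioo (0 : ℝ) 1) {ν : Fin n → ℝ}
    (hν : ∀ i, 0 ≤ ν i) {P : Matrix (Fin n) (Fin n) ℝ} (hP : ∀ i j, 0 ≤ P i j)
    (hsum : ∀ i, ∑ j, P i j = 1) (i : Fin n) : 0 ≤ ppr α ν P i := by
  set x := ppr α ν P with hx
  have hfix := ppr_eq_add ν (det_one_sub_smul_ne_zero hα hP hsum)
  rw [← hx] at hfix
  have hneg : ∀ j, (x j)⁻ ≤ α * ∑ i, (x i)⁻ * P i j := by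
    intro j
    rw [negPart_def]
    refine sup_le ?_ ?_
    · have h : -∑ i, x i * P i j ≤ ∑ i, (x i)⁻ * P i j := by
        rw [← Finset.sum_neg_distrib]
        refine Finset.sum_le_sum fun i _ => ?_
        rw [← neg_mul]
        exact mul_le_mul_of_nonneg_right (neg_le_negPart _) (hP i j)
      have h1 : 0 ≤ (1 - α) * ν j := mul_nonneg (by linarith [hα.2]) (hν j)
      have h2 := mul_le_mul_of_nonneg_left h hα.1.le
      rw [hfix j]
      linarith
    · exact mul_nonneg hα.1.le
        (Finset.sum_nonneg fun i _ => mul_nonneg (negPart_nonneg _) (hP i j))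
  have htot : ∑ j, (x j)⁻ ≤ α * ∑ j, (x j)⁻ := by
    calc ∑ j, (x j)⁻ ≤ ∑ j, α * ∑ i, (x i)⁻ * P i j := Finset.sum_le_sum fun j _ => hneg j
      _ = α * ∑ j, (x j)⁻ := by
        rw [← Finset.mul_sum, Finset.sum_comm]
        simp_rw [← Finset.mul_sum, hsum, mul_one]
  have hle : (x i)⁻ ≤ ∑ j, (x j)⁻ :=
    Finset.single_le_sum (f := fun j => (x j)⁻) (fun j _ => negPart_nonneg _)
      (Finset.mem_univ i)
  have hzero : (x i)⁻ ≤ 0 := by nlinarith [hα.2]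
  linarith [neg_le_negPart (x i)]

lemma sum_ppr {n : ℕ} {α : ℝ} (hα : α ∈ Set.Ioo (0 : ℝ) 1) (ν : Fin n → ℝ)
    {P : Matrix (Fin n) (Fin n) ℝ} (hP : ∀ i j, 0 ≤ P i j) (hsum : ∀ i, ∑ j, P i j = 1) :
    ∑ i, ppr α ν P i = ∑ i, ν i := by
  have hfix := ppr_eq_add ν (det_one_sub_smul_ne_zero hα hP hsum)
  have h : ∑ j, ppr α ν P j = (1 - α) * ∑ j, ν j + α * ∑ j, ppr α ν P j := by
    conv_lhs => rw [Finset.sum_congr rfl fun j _ => hfix j]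
    rw [Finset.sum_add_distrib, ← Finset.mul_sum, ← Finset.mul_sum, Finset.sum_comm]
    simp_rw [← Finset.mul_sum, hsum, mul_one]
  have hne : 1 - α ≠ 0 := by linarith [hα.2]
  exact mul_left_cancel₀ hne (by linarith)

/-! ### Equivariance under relabelling of the vertices -/

lemma transMat_submatrix {n : ℕ} (A : Matrix (Fin n) (Fin n) ℝ) (σ : Equiv.Perm (Fin n)) :
    transMat (A.submatrix σ σ) = (transMat A).submatrix σ σ := by
  have hdeg : ∀ i, deg (A.submatrix σ σ) i = deg A (σ i) := fun i =>
    Equiv.sum_comp σ (fun j => A (σ i) j)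
  ext i j
  simp [transMat, hdeg]

lemma ppr_submatrix {n : ℕ} (α : ℝ) {ν : Fin n → ℝ} (P : Matrix (Fin n) (Fin n) ℝ)
    {σ : Equiv.Perm (Fin n)} (hν : ∀ i, ν (σ i) = ν i) (i : Fin n) :
    ppr α ν (P.submatrix σ σ) i = ppr α ν P (σ i) := by
  have h : 1 - α • P.submatrix σ σ = (1 - α • P).submatrix σ σ := by
    ext a b
    simp [Matrix.one_apply]
  unfold ppr
  rw [h, Matrix.inv_submatrix_equiv]
  simp only [Pi.smul_apply, Matrix.vecMul, dotProduct, Matrix.submatrix_apply]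
  rw [← Equiv.sum_comp σ (fun a => ν a * (1 - α • P)⁻¹ a (σ i))]
  simp_rw [hν]

/-! ### Invariance in law of the planted model -/

/-- The edge slots `i < j`. -/
abbrev EdgeSlot (n : ℕ) := {e : Fin n × Fin n // e.1 < e.2}

/-- The edge slot of the image of an edge slot under a vertex permutation. -/
def EdgeSlot.relabel {n : ℕ} (σ : Equiv.Perm (Fin n)) (e : EdgeSlot n) : EdgeSlot n :=
  if h : σ e.1.1 < σ e.1.2 then ⟨(σ e.1.1, σ e.1.2), h⟩
  else ⟨(σ e.1.2, σ e.1.1),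
    lt_of_le_of_ne (not_lt.mp h) fun h' => e.2.ne (σ.injective h').symm⟩

lemma EdgeSlot.relabel_injective {n : ℕ} (σ : Equiv.Perm (Fin n)) :
    Function.Injective (EdgeSlot.relabel σ) := by
  rintro ⟨⟨a, b⟩, hab⟩ ⟨⟨c, d⟩, hcd⟩ h
  simp only at hab hcd
  unfold EdgeSlot.relabel at h
  split_ifs at h <;>
  · simp only [Subtype.mk.injEq, Prod.mk.injEq, EmbeddingLike.apply_eq_iff_eq] at h
    obtain ⟨rfl, rfl⟩ := h
    first
      | rfl
      | exact absurd hab hcd.asymm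

/-- The presence indicators of the edges of a `{0,1}`-matrix. -/
def edgeIndicator {n : ℕ} (A : Matrix (Fin n) (Fin n) ℝ) (e : EdgeSlot n) : Bool :=
  decide (A e.1.1 e.1.2 = 1)

/-- The symmetric hollow `{0,1}`-matrix with given edge indicators. -/
def ofEdgeIndicator {n : ℕ} (x : EdgeSlot n → Bool) : Matrix (Fin n) (Fin n) ℝ :=
  fun i j => if h : i < j then (if x ⟨(i, j), h⟩ then 1 else 0)
    else if h : j < i then (if x ⟨(j, i), h⟩ then 1 else 0) else 0

lemma ofEdgeIndicator_edgeIndicator {n : ℕ} {A : Matrix (Fin n) (Fin n) ℝ}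
    (hsymm : ∀ i j, A i j = A j i) (hdiag : ∀ i, A i i = 0)
    (hA : ∀ i j, A i j = 0 ∨ A i j = 1) : ofEdgeIndicator (edgeIndicator A) = A := by
  have hind : ∀ i j, (if A i j = 1 then (1 : ℝ) else 0) = A i j := by
    intro i j
    rcases hA i j with h | h <;> simp [h]
  ext i j
  simp only [ofEdgeIndicator, edgeIndicator, decide_eq_true_eq, hind]
  split_ifs with h1 h2
  · rfl
  · exact hsymm j i
  · rw [le_antisymm (not_lt.mp h2) (not_lt.mp h1), hdiag]

lemma edgeIndicator_submatrix {n : ℕ} {A : Matrix (Fin n) (Fin n) ℝ}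
    (hsymm : ∀ i j, A i j = A j i) (σ : Equiv.Perm (Fin n)) (e : EdgeSlot n) :
    edgeIndicator (A.submatrix σ σ) e = edgeIndicator A (e.relabel σ) := by
  unfold EdgeSlot.relabel edgeIndicator
  split_ifs
  · rfl
  · simp [hsymm (σ e.1.1)]

lemma identDistrib_bool {Ω Ω' : Type*} [MeasurableSpace Ω] [MeasurableSpace Ω']
    {μ : Measure Ω} {ν : Measure Ω'} [IsProbabilityMeasure μ] [IsProbabilityMeasure ν]
    {f : Ω → Bool} {g : Ω' → Bool}
    (hf : Measurable f) (hg : Measurable g) (h : μ (f ⁻¹' {true}) = ν (g ⁻¹' {true})) :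
    IdentDistrib f g μ ν := by
  refine ⟨hf.aemeasurable, hg.aemeasurable, Measure.ext_of_singleton fun b => ?_⟩
  rw [Measure.map_apply hf (measurableSet_singleton b),
    Measure.map_apply hg (measurableSet_singleton b)]
  cases b
  · have hfalse : ({false} : Set Bool) = {true}ᶜ := by
      ext b
      simp
    rw [hfalse, Set.preimage_compl, Set.preimage_compl,
      prob_compl_eq_one_sub (hf (measurableSet_singleton _)),
      prob_compl_eq_one_sub (hg (measurableSet_singleton _)), h]
  · exact h

namespace PlantedModel

variable {Ω : Type*} [MeasurableSpace Ω] {μ : Measure Ω} {n m : ℕ} {p q : ℝ}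
  {A : Ω → Matrix (Fin n) (Fin n) ℝ}

lemma measurable_edgeIndicator (hA : PlantedModel μ n m p q A) (e : EdgeSlot n) :
    Measurable fun ω => edgeIndicator (A ω) e :=
  measurable_to_bool (by
    simpa [Set.preimage, edgeIndicator] using
      hA.meas e.1.1 e.1.2 (measurableSet_singleton 1))

lemma iIndepFun_edgeIndicator (hA : PlantedModel μ n m p q A) :
    iIndepFun (fun (e : EdgeSlot n) ω => edgeIndicator (A ω) e) μ :=
  hA.indep.comp (fun _ x => decide (x = 1)) fun _ =>
    measurable_to_bool (by simp [Set.preimage])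

lemma identDistrib_edgeIndicator_relabel [IsProbabilityMeasure μ]
    (hA : PlantedModel μ n m p q A) {σ : Equiv.Perm (Fin n)}
    (hσ : ∀ i, (σ i : ℕ) < m ↔ (i : ℕ) < m) :
    IdentDistrib (fun ω (e : EdgeSlot n) => edgeIndicator (A ω) e)
      (fun ω (e : EdgeSlot n) => edgeIndicator (A ω) (e.relabel σ)) μ μ := by
  refine IdentDistrib.pi (fun e => ?_) hA.iIndepFun_edgeIndicator
    (hA.iIndepFun_edgeIndicator.precomp (EdgeSlot.relabel_injective σ))
  refine identDistrib_bool (hA.measurable_edgeIndicator e)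
    (hA.measurable_edgeIndicator (e.relabel σ)) ?_
  have hprob : ∀ e : EdgeSlot n, μ ((fun ω => edgeIndicator (A ω) e) ⁻¹' {true})
      = ENNReal.ofReal (if (e.1.1 : ℕ) < m ∧ (e.1.2 : ℕ) < m then q else p) := by
    intro e
    rw [← hA.mean e.1.1 e.1.2 e.2]
    simp [Set.preimage, edgeIndicator]
  rw [hprob, hprob]
  unfold EdgeSlot.relabel
  by_cases h : σ e.1.1 < σ e.1.2
  · simp only [dif_pos h, hσ]
  · simp only [dif_neg h, hσ, and_comm]

lemma identDistrib_comp [IsProbabilityMeasure μ]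
    (hA : PlantedModel μ n m p q A) {σ : Equiv.Perm (Fin n)}
    (hσ : ∀ i, (σ i : ℕ) < m ↔ (i : ℕ) < m) (F : Matrix (Fin n) (Fin n) ℝ → ℝ) :
    IdentDistrib (fun ω => F (A ω)) (fun ω => F ((A ω).submatrix σ σ)) μ μ := by
  have h := (hA.identDistrib_edgeIndicator_relabel hσ).comp
    (u := fun x => F (ofEdgeIndicator x)) (measurable_of_finite _)
  convert h using 1
  · funext ω
    exact congrArg F (ofEdgeIndicator_edgeIndicator (hA.symm ω) (hA.diag ω)
      (hA.zeroOne ω)).symm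
  · funext ω
    refine congrArg F ?_
    rw [← ofEdgeIndicator_edgeIndicator (A := (A ω).submatrix σ σ)
      (fun _ _ => hA.symm ω _ _) (fun _ => hA.diag ω _) (fun _ _ => hA.zeroOne ω _ _)]
    exact congrArg ofEdgeIndicator (funext (edgeIndicator_submatrix (hA.symm ω) σ))

lemma measurable_comp (hA : PlantedModel μ n m p q A) (F : Matrix (Fin n) (Fin n) ℝ → ℝ) :
    Measurable fun ω => F (A ω) := by
  have h : Measurable fun ω => F (ofEdgeIndicator (edgeIndicator (A ω))) :=
    (measurable_of_finite fun x => F (ofEdgeIndicator x)).comp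
      (measurable_pi_lambda _ hA.measurable_edgeIndicator)
  convert h using 3 with ω
  exact (ofEdgeIndicator_edgeIndicator (hA.symm ω) (hA.diag ω) (hA.zeroOne ω)).symm

lemma identDistrib_ppr [IsProbabilityMeasure μ] (hA : PlantedModel μ n m p q A) (α : ℝ)
    {k : ℕ} {i j : Fin n} (hm : (i : ℕ) < m ↔ (j : ℕ) < m) (hk : (i : ℕ) < k ↔ (j : ℕ) < k) :
    IdentDistrib (fun ω => ppr α (restart n k) (transMat (A ω)) i)
      (fun ω => ppr α (restart n k) (transMat (A ω)) j) μ μ := by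
  have hswap : ∀ {l : ℕ}, ((i : ℕ) < l ↔ (j : ℕ) < l) →
      ∀ a, (Equiv.swap i j a : ℕ) < l ↔ (a : ℕ) < l := by
    intro l hl a
    rw [Equiv.swap_apply_def]
    split_ifs with h1 h2
    · rw [h1, hl]
    · rw [h2, hl]
    · exact Iff.rfl
  convert hA.identDistrib_comp (hswap hm)
    (fun B => ppr α (restart n k) (transMat B) i) using 2 with ω
  rw [transMat_submatrix, ppr_submatrix α _ (fun a => by simp only [restart, hswap hk a]),
    Equiv.swap_apply_left]

lemma integral_ppr_le [IsProbabilityMeasure μ] (hA : PlantedModel μ n m p q A) {α : ℝ}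
    (hα : α ∈ Set.Ioo (0 : ℝ) 1) {k : ℕ} (hk : 1 ≤ k) (hkn : k ≤ n)
    {s : Finset (Fin n)} {i : Fin n} (hi : i ∈ s)
    (hs : ∀ j ∈ s, IdentDistrib (fun ω => ppr α (restart n k) (transMat (A ω)) i)
      (fun ω => ppr α (restart n k) (transMat (A ω)) j) μ μ) :
    ∫ ω, ppr α (restart n k) (transMat (A ω)) i ∂μ ≤ 1 / (s.card : ℝ) := by
  set X : Fin n → Ω → ℝ := fun j ω => ppr α (restart n k) (transMat (A ω)) j with hX
  have hpos : ∀ ω a b, 0 ≤ A ω a b := fun ω a b => by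
    rcases hA.zeroOne ω a b with h | h <;> simp [h]
  have hnonneg : ∀ j ω, 0 ≤ X j ω := fun j ω =>
    ppr_nonneg hα (restart_nonneg n k) (transMat_nonneg (hpos ω)) (sum_transMat _) j
  have hsum : ∀ ω, ∑ j, X j ω = 1 := fun ω => by
    rw [← sum_restart hk hkn]
    exact sum_ppr hα _ (transMat_nonneg (hpos ω)) (sum_transMat _)
  have hle : ∀ (t : Finset (Fin n)) ω, ∑ j ∈ t, X j ω ≤ 1 := fun t ω =>
    (hsum ω).symm ▸ Finset.sum_le_univ_sum_of_nonneg fun j => hnonneg j ω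
  have hint : ∀ j, Integrable (X j) μ := fun j =>
    Integrable.of_bound
      (hA.measurable_comp fun B => ppr α (restart n k) (transMat B) j).aestronglyMeasurable 1
      (ae_of_all _ fun ω => by
        rw [Real.norm_of_nonneg (hnonneg j ω)]
        simpa using hle {j} ω)
  have htotal : (s.card : ℝ) * ∫ ω, X i ω ∂μ ≤ 1 := by
    calc (s.card : ℝ) * ∫ ω, X i ω ∂μ = ∑ j ∈ s, ∫ ω, X j ω ∂μ := by
          rw [← nsmul_eq_mul, ← Finset.sum_const]
          exact Finset.sum_congr rfl fun j hj => (hs j hj).integral_eq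
      _ = ∫ ω, ∑ j ∈ s, X j ω ∂μ := (integral_finsetSum s fun j _ => hint j).symm
      _ ≤ ∫ _, (1 : ℝ) ∂μ :=
          integral_mono (integrable_finsetSum s fun j _ => hint j) (integrable_const 1) (hle s)
      _ = 1 := by simp
  have hcard : (0 : ℝ) < s.card := by exact_mod_cast Finset.card_pos.mpr ⟨i, hi⟩
  rwa [le_div_iff₀' hcard]

end PlantedModel

lemma card_filter_val_mem_Ico {n a b : ℕ} (hb : b ≤ n) :
    (Finset.univ.filter fun i : Fin n => a ≤ (i : ℕ) ∧ (i : ℕ) < b).card = b - a := by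
  rw [← Finset.card_map Fin.valEmbedding, ← Nat.card_Ico]
  congr 1
  ext x
  simp only [Finset.mem_map, Finset.mem_filter, Finset.mem_univ, true_and,
    Fin.valEmbedding_apply, Finset.mem_Ico]
  exact ⟨by rintro ⟨i, hi, rfl⟩; exact hi, fun hx => ⟨⟨x, by omega⟩, hx, rfl⟩⟩

/-- for fixed `n` with `k < m < n`, the PPR values are identically distributed
within `C∖S` and within the complement of `C`, and the stated expectation bounds hold. -/
theorem ppr_exchangeable_and_expectation_bounds
    {Ω : Type*} [MeasurableSpace Ω] (μ : Measure Ω) [IsProbabilityMeasure μ]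
    (α : ℝ) (hα : α ∈ Set.Ioo (0 : ℝ) 1)
    (n m k : ℕ) (hk : 1 ≤ k) (hkm : k < m) (hmn : m < n)
    (p q : ℝ) (hp : p ∈ Set.Ioo (0 : ℝ) 1) (hq : q ∈ Set.Ioo (0 : ℝ) 1) (hpq : p ≤ q)
    (A : Ω → Matrix (Fin n) (Fin n) ℝ)
    (hmodel : PlantedModel μ n m p q A) :
    (∀ i j : Fin n, k ≤ (i : ℕ) → (i : ℕ) < m → k ≤ (j : ℕ) → (j : ℕ) < m →
      ProbabilityTheory.IdentDistrib
        (fun ω => ppr α (restart n k) (transMat (A ω)) i)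
        (fun ω => ppr α (restart n k) (transMat (A ω)) j) μ μ) ∧
    (∀ i j : Fin n, m ≤ (i : ℕ) → m ≤ (j : ℕ) →
      ProbabilityTheory.IdentDistrib
        (fun ω => ppr α (restart n k) (transMat (A ω)) i)
        (fun ω => ppr α (restart n k) (transMat (A ω)) j) μ μ) ∧
    (∀ i : Fin n, k ≤ (i : ℕ) → (i : ℕ) < m →
      ∫ ω, ppr α (restart n k) (transMat (A ω)) i ∂μ ≤ 1 / ((m : ℝ) - k)) ∧
    (∀ i : Fin n, m ≤ (i : ℕ) →
      ∫ ω, ppr α (restart n k) (transMat (A ω)) i ∂μ ≤ 1 / ((n : ℝ) - m)) := by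
  have hC : ∀ i j : Fin n, k ≤ (i : ℕ) → (i : ℕ) < m → k ≤ (j : ℕ) → (j : ℕ) < m →
      IdentDistrib (fun ω => ppr α (restart n k) (transMat (A ω)) i)
        (fun ω => ppr α (restart n k) (transMat (A ω)) j) μ μ :=
    fun i j hi hi' hj hj' => hmodel.identDistrib_ppr α (by omega) (by omega)
  have hCc : ∀ i j : Fin n, m ≤ (i : ℕ) → m ≤ (j : ℕ) →
      IdentDistrib (fun ω => ppr α (restart n k) (transMat (A ω)) i)
        (fun ω => ppr α (restart n k) (transMat (A ω)) j) μ μ :=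
    fun i j hi hj => hmodel.identDistrib_ppr α (by omega) (by omega)
  refine ⟨hC, hCc, fun i hi hi' => ?_, fun i hi => ?_⟩
  · rw [← Nat.cast_sub hkm.le, ← card_filter_val_mem_Ico (a := k) hmn.le]
    refine hmodel.integral_ppr_le hα hk (by omega) (by simp [hi, hi']) fun j hj => ?_
    have hj' := (Finset.mem_filter.mp hj).2
    exact hC i j hi hi' hj'.1 hj'.2
  · rw [← Nat.cast_sub hmn.le, ← card_filter_val_mem_Ico (a := m) le_rfl]
    refine hmodel.integral_ppr_le hα hk (by omega) (by simp [hi]) fun j hj => ?_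
    exact hCc i j hi (Finset.mem_filter.mp hj).2.1
end
end

section
/- Fix n with k(n) < m(n) < n. Then for every i ∈ C∖S, E(π_i) ≥ (1−α) α q(n) / (1 + (m(n)−1) q(n) + (n−m(n)) p(n)). (The bound is obtained by keeping only the one-step contributions through seed neighbours of i and applying Jensen's inequality to the reciprocal degrees.) -/
open MeasureTheory ProbabilityTheory Filter Finset Topology

noncomputable section

/-- Personalized PageRank written as the series `(1-α) ν ∑_{l≥0} α^l P^l`. -/
def pprSeries {n : ℕ} (α : ℝ) (ν : Fin n → ℝ) (P : Matrix (Fin n) (Fin n) ℝ) : Fin n → ℝ :=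
  (1 - α) • Matrix.vecMul ν (∑' l : ℕ, α ^ l • P ^ l)

namespace Matrix

variable {ι : Type*} [Fintype ι] [DecidableEq ι]

lemma summable_smul_pow_of_mem_rowStochastic {P : Matrix ι ι ℝ} (hP : P ∈ rowStochastic ℝ ι)
    {α : ℝ} (h0 : 0 ≤ α) (h1 : α < 1) : Summable fun l : ℕ => α ^ l • P ^ l := by
  refine Pi.summable.2 fun i => Pi.summable.2 fun j => ?_
  refine Summable.of_nonneg_of_le (fun l => ?_) (fun l => ?_) (summable_geometric_of_lt_one h0 h1)
  · exact mul_nonneg (pow_nonneg h0 l) (nonneg_of_mem_rowStochastic (pow_mem hP l))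
  · exact mul_le_of_le_one_right (pow_nonneg h0 l) (le_one_of_mem_rowStochastic (pow_mem hP l))

lemma mul_apply_le_tsum_smul_pow_apply {P : Matrix ι ι ℝ} (hP : P ∈ rowStochastic ℝ ι)
    {α : ℝ} (h0 : 0 ≤ α) (h1 : α < 1) (i j : ι) :
    α * P i j ≤ (∑' l : ℕ, α ^ l • P ^ l) i j := by
  have hs := summable_smul_pow_of_mem_rowStochastic hP h0 h1
  have hs_row := Pi.summable.1 hs i
  have hs_entry := Pi.summable.1 hs_row j
  have hentry : (∑' l : ℕ, α ^ l • P ^ l) i j = ∑' l : ℕ, (α ^ l • P ^ l) i j :=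
    (congrFun (tsum_apply hs) j).trans (tsum_apply hs_row)
  rw [hentry]
  have := hs_entry.le_tsum 1 fun l _ =>
    mul_nonneg (pow_nonneg h0 l) (nonneg_of_mem_rowStochastic (pow_mem hP l))
  simpa using this

end Matrix

lemma transMat_mem_rowStochastic {n : ℕ} {A : Matrix (Fin n) (Fin n) ℝ}
    (hA : ∀ i j, 0 ≤ A i j) : transMat A ∈ Matrix.rowStochastic ℝ (Fin n) := by
  refine Matrix.mem_rowStochastic_iff_sum.2 ⟨fun i j => ?_, fun i => ?_⟩
  · have : 0 ≤ deg A i := sum_nonneg fun j _ => hA i j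
    unfold transMat
    split_ifs <;> first | positivity | exact div_nonneg (hA i j) this
  · by_cases h : deg A i = 0
    · simp [transMat, h]
    · simp only [transMat, h, if_false, ← sum_div]
      exact div_self h

/-- Keeping only the one-step term of the series bounds Personalized PageRank from below. -/
lemma one_step_le_pprSeries {n : ℕ} {α : ℝ} (h0 : 0 ≤ α) (h1 : α < 1) {ν : Fin n → ℝ}
    (hν : ∀ i, 0 ≤ ν i) {P : Matrix (Fin n) (Fin n) ℝ}
    (hP : P ∈ Matrix.rowStochastic ℝ (Fin n)) (i : Fin n) :
    ∑ j, ν j * ((1 - α) * α * P j i) ≤ pprSeries α ν P i := by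
  simp only [pprSeries, Pi.smul_apply, smul_eq_mul, Matrix.vecMul, dotProduct, mul_sum]
  refine sum_le_sum fun j _ => ?_
  calc ν j * ((1 - α) * α * P j i) = (1 - α) * (ν j * (α * P j i)) := by ring
    _ ≤ _ := mul_le_mul_of_nonneg_left (mul_le_mul_of_nonneg_left
        (Matrix.mul_apply_le_tsum_smul_pow_apply hP h0 h1 j i) (hν j)) (sub_nonneg.2 h1.le)

/-- The tangent line of `x ↦ x⁻¹` at `c` bounds the transition probabilities from below. -/
lemma tangent_le_transMat {n : ℕ} {A : Matrix (Fin n) (Fin n) ℝ}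
    (hA : ∀ i j, A i j = 0 ∨ A i j = 1) {c : ℝ} (hc : 0 < c) (j i : Fin n) :
    2 / c * A j i - (c ^ 2)⁻¹ * ∑ l, A j i * A j l ≤ transMat A j i := by
  have hA0 : ∀ i j, 0 ≤ A i j := fun i j => by rcases hA i j with h | h <;> simp [h]
  rcases hA j i with h | h
  · simpa [h] using Matrix.nonneg_of_mem_rowStochastic (transMat_mem_rowStochastic hA0)
  · have hd : 1 ≤ deg A j := h ▸ single_le_sum (fun l _ => hA0 j l) (mem_univ i)
    have hd0 : 0 < deg A j := by linarith
    simp only [transMat, hd0.ne', if_false, h, one_mul]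
    change 2 / c * 1 - (c ^ 2)⁻¹ * deg A j ≤ 1 / deg A j
    rw [← sub_nonneg]
    have : 1 / deg A j - (2 / c * 1 - (c ^ 2)⁻¹ * deg A j)
        = (deg A j - c) ^ 2 / (c ^ 2 * deg A j) := by
      field_simp
      ring
    rw [this]
    positivity

lemma sum_meanA_row {n m : ℕ} (hmn : m ≤ n) (p q : ℝ) {j : Fin n} (hj : (j : ℕ) < m) :
    ∑ l, meanA n m p q j l = m * q + (n - m) * p := by
  simp only [meanA, hj, true_and]
  rw [Fin.sum_univ_eq_sum_range (fun l => if l < m then q else p), sum_ite, sum_const, sum_const,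
    show (range n).filter (· < m) = range m by ext; simp; omega,
    show (range n).filter (¬ · < m) = Ico m n by ext; simp; omega]
  simp [Nat.cast_sub hmn]

namespace PlantedModel

variable {Ω : Type*} [MeasurableSpace Ω] {μ : Measure Ω} {n m : ℕ} {p q : ℝ}
  {A : Ω → Matrix (Fin n) (Fin n) ℝ}

lemma integrable_comp [IsFiniteMeasure μ] (h : PlantedModel μ n m p q A)
    (f : Matrix (Fin n) (Fin n) ℝ → ℝ) : Integrable (fun ω => f (A ω)) μ := by
  classical
  let B : Ω → Fin n → Fin n → Bool := fun ω i j => decide (A ω i j = 1)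
  let g : (Fin n → Fin n → Bool) → Matrix (Fin n) (Fin n) ℝ := fun b i j => if b i j then 1 else 0
  have hB : Measurable B := by
    refine measurable_pi_lambda _ fun i => measurable_pi_lambda _ fun j => ?_
    exact measurable_to_bool (by
      convert h.meas i j (measurableSet_singleton 1) using 1
      ext ω
      simp [B])
  have hg : ∀ ω, g (B ω) = A ω := fun ω => by
    ext i j
    rcases h.zeroOne ω i j with h' | h' <;> simp [g, B, h']
  have := (Integrable.of_finite (μ := μ.map B) (f := fun b => f (g b))).comp_measurable hB
  simpa only [Function.comp_def, hg] using this

lemma integral_entry (h : PlantedModel μ n m p q A) (hp : 0 ≤ p) (hq : 0 ≤ q)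
    {i j : Fin n} (hij : i ≠ j) : ∫ ω, A ω i j ∂μ = meanA n m p q i j := by
  wlog hlt : i < j generalizing i j
  · simp_rw [h.symm _ i j, this hij.symm (lt_of_le_of_ne (not_lt.1 hlt) hij.symm), meanA, and_comm]
  have hind : (fun ω => A ω i j) = {ω | A ω i j = 1}.indicator 1 := by
    ext ω
    rcases h.zeroOne ω i j with h' | h' <;> simp [Set.indicator, h']
  have hset : MeasurableSet {ω | A ω i j = 1} := h.meas i j (measurableSet_singleton 1)
  rw [hind, integral_indicator_one hset, measureReal_def,
    h.mean i j hlt, ENNReal.toReal_ofReal (by split_ifs <;> assumption)]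
  rfl

lemma indepFun_row (h : PlantedModel μ n m p q A) {i j l : Fin n} (hji : j ≠ i) (hjl : j ≠ l)
    (hil : i ≠ l) : IndepFun (fun ω => A ω j i) (fun ω => A ω j l) μ := by
  have key : ∀ s : Fin n, j ≠ s → ∃ e : {e : Fin n × Fin n // e.1 < e.2},
      (fun ω => A ω j s) = (fun ω => A ω e.1.1 e.1.2) ∧
        (e.1 = (j, s) ∨ e.1 = (s, j)) := fun s hs => by
    rcases lt_or_gt_of_ne hs with h' | h'
    · exact ⟨⟨(j, s), h'⟩, rfl, .inl rfl⟩
    · exact ⟨⟨(s, j), h'⟩, funext fun ω => h.symm ω j s, .inr rfl⟩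
  obtain ⟨e, he, hei⟩ := key i hji
  obtain ⟨e', he', hel⟩ := key l hjl
  rw [he, he']
  refine h.indep.indepFun fun hee => ?_
  subst hee
  grind

lemma integral_entry_mul_entry_le (h : PlantedModel μ n m p q A) (hp : 0 ≤ p) (hq : 0 ≤ q)
    {i j : Fin n} (hji : j ≠ i) (l : Fin n) :
    ∫ ω, A ω j i * A ω j l ∂μ ≤ meanA n m p q j i *
      (meanA n m p q j l + if l = i then 1 - meanA n m p q j i else 0) := by
  have hmean : ∀ s t : Fin n, 0 ≤ meanA n m p q s t := fun s t => by
    unfold meanA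
    split_ifs <;> assumption
  by_cases hli : l = i
  · subst hli
    have hsq : ∀ ω, A ω j l * A ω j l = A ω j l := fun ω => by
      rcases h.zeroOne ω j l with h' | h' <;> simp [h']
    simp [hsq, h.integral_entry hp hq hji]
  by_cases hlj : j = l
  · subst hlj
    simp [h.diag, hli, mul_nonneg, hmean]
  rw [(h.indepFun_row hji hlj (Ne.symm hli)).integral_fun_mul_eq_mul_integral
    (h.meas j i).aestronglyMeasurable (h.meas j l).aestronglyMeasurable,
    h.integral_entry hp hq hji, h.integral_entry hp hq hlj]
  simp [hli]

lemma le_integral_transMat [IsFiniteMeasure μ] (h : PlantedModel μ n m p q A) (hp : 0 ≤ p)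
    (hq : 0 ≤ q) (hmn : m ≤ n) {i j : Fin n} (hji : j ≠ i) (hj : (j : ℕ) < m)
    (hi : (i : ℕ) < m) :
    q / (1 + ((m : ℝ) - 1) * q + ((n : ℝ) - m) * p) ≤ ∫ ω, transMat (A ω) j i ∂μ := by
  set c : ℝ := 1 + ((m : ℝ) - 1) * q + ((n : ℝ) - m) * p with hc_def
  have hc : 0 < c := by
    have hm : (1 : ℝ) ≤ m := by exact_mod_cast (by omega : 1 ≤ m)
    have hn : (m : ℝ) ≤ n := by exact_mod_cast hmn
    have := mul_nonneg (sub_nonneg.2 hm) hq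
    have := mul_nonneg (sub_nonneg.2 hn) hp
    linarith
  have hmean : meanA n m p q j i = q := by simp [meanA, hi, hj]
  have hsum : ∫ ω, ∑ l, A ω j i * A ω j l ∂μ ≤ q * c := by
    rw [integral_finsetSum _ fun l _ => h.integrable_comp fun M => M j i * M j l]
    refine (sum_le_sum fun l _ => h.integral_entry_mul_entry_le hp hq hji l).trans_eq ?_
    rw [← mul_sum, sum_add_distrib, sum_meanA_row hmn p q hj, hmean]
    simp only [sum_ite_eq', mem_univ, if_true, hc_def]
    ring
  calc q / c = 2 / c * q - (c ^ 2)⁻¹ * (q * c) := by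
        field_simp
        ring
    _ ≤ 2 / c * q - (c ^ 2)⁻¹ * ∫ ω, ∑ l, A ω j i * A ω j l ∂μ := by gcongr
    _ = ∫ ω, (2 / c * A ω j i - (c ^ 2)⁻¹ * ∑ l, A ω j i * A ω j l) ∂μ := by
        rw [integral_sub (h.integrable_comp fun M => 2 / c * M j i)
          (h.integrable_comp fun M => (c ^ 2)⁻¹ * ∑ l, M j i * M j l), integral_const_mul,
          integral_const_mul, h.integral_entry hp hq hji, hmean]
    _ ≤ ∫ ω, transMat (A ω) j i ∂μ :=
        integral_mono
          (h.integrable_comp fun M => 2 / c * M j i - (c ^ 2)⁻¹ * ∑ l, M j i * M j l)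
          (h.integrable_comp fun M => transMat M j i)
          fun ω => tangent_le_transMat (h.zeroOne ω) hc j i

end PlantedModel

/-- a lower bound on the expected PPR of a non-seed community node. -/
theorem ppr_expectation_lower_bound
    {Ω : Type*} [MeasurableSpace Ω] (μ : Measure Ω) [IsProbabilityMeasure μ]
    (α : ℝ) (hα : α ∈ Set.Ioo (0 : ℝ) 1)
    (n m k : ℕ) (hk : 1 ≤ k) (hkm : k < m) (hmn : m < n)
    (p q : ℝ) (hp : p ∈ Set.Ioo (0 : ℝ) 1) (hq : q ∈ Set.Ioo (0 : ℝ) 1) (hpq : p ≤ q)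
    (A : Ω → Matrix (Fin n) (Fin n) ℝ)
    (hmodel : PlantedModel μ n m p q A) :
    ∀ i : Fin n, k ≤ (i : ℕ) → (i : ℕ) < m →
      (1 - α) * α * q / (1 + ((m : ℝ) - 1) * q + ((n : ℝ) - m) * p) ≤
        ∫ ω, pprSeries α (restart n k) (transMat (A ω)) i ∂μ := by
  intro i hki him
  have h1α : 0 ≤ 1 - α := sub_nonneg.2 hα.2.le
  have hint : ∀ j, Integrable (fun ω => restart n k j * ((1 - α) * α * transMat (A ω) j i)) μ :=
    fun j => hmodel.integrable_comp fun M => restart n k j * ((1 - α) * α * transMat M j i)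
  calc (1 - α) * α * q / (1 + ((m : ℝ) - 1) * q + ((n : ℝ) - m) * p)
      = ∑ j, restart n k j *
          ((1 - α) * α * (q / (1 + ((m : ℝ) - 1) * q + ((n : ℝ) - m) * p))) := by
        rw [← sum_mul, sum_restart hk (by omega), one_mul, mul_div_assoc]
    _ ≤ ∑ j, restart n k j * ((1 - α) * α * ∫ ω, transMat (A ω) j i ∂μ) := by
        refine sum_le_sum fun j _ => ?_
        by_cases hj : (j : ℕ) < k
        · have hji : j ≠ i := fun h => by subst h; omega
          exact mul_le_mul_of_nonneg_left (mul_le_mul_of_nonneg_left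
            (hmodel.le_integral_transMat hp.1.le hq.1.le hmn.le hji (hj.trans hkm) him)
            (mul_nonneg h1α hα.1.le)) (restart_nonneg n k j)
        · simp [restart, hj]
    _ = ∫ ω, ∑ j, restart n k j * ((1 - α) * α * transMat (A ω) j i) ∂μ := by
        rw [integral_finsetSum _ fun j _ => hint j]
        simp_rw [integral_const_mul]
    _ ≤ ∫ ω, pprSeries α (restart n k) (transMat (A ω)) i ∂μ := by
        refine integral_mono (integrable_finsetSum _ fun j _ => hint j)
          (hmodel.integrable_comp fun M => pprSeries α (restart n k) (transMat M) i) fun ω => ?_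
        refine one_step_le_pprSeries hα.1.le hα.2 (restart_nonneg n k)
          (transMat_mem_rowStochastic fun s t => ?_) i
        rcases hmodel.zeroOne ω s t with h | h <;> simp [h]
end
end
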